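/- arXiv:2502.06459 — 4 statements merged into one kernel-verified Lean document; each statement's English description precedes it below -/
import Mathlib

section
/- For every finite partially ordered set (V, ≤) and every positive integer k, the maximum cardinality of the union of k pairwise disjoint antichains of V equals the minimum, over all partitions 𝒞 of V into chains, of the k-norm Σ_{C∈𝒞} min(|C|, k). -/
/-- **Egerváry's theorem** for square integer matrices: some integral potentials dominating `c`
are tight along an injective assignment. -/
theorem exists_potentials_tight_injective {V : Type*} [Fintype V] (c : V → V → ℤ) :
    ∃ (u w : V → ℤ) (σ : V → V), (∀ i j, c i j ≤ u i + w j) ∧ Function.Injective σ ∧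
      ∀ i, u i + w (σ i) = c i (σ i) := by
  classical
  have descent : ∀ (n : ℕ) (u w : V → ℤ), (∀ i j, c i j ≤ u i + w j) →
      ∑ i, u i + ∑ i, w i - ∑ i, c i i = n →
      ∃ (u w : V → ℤ) (σ : V → V), (∀ i j, c i j ≤ u i + w j) ∧ Function.Injective σ ∧
        ∀ i, u i + w (σ i) = c i (σ i) := by
    intro n
    induction n using Nat.strong_induction_on with
    | _ n ih =>
      intro u w huw hn
      let T : V → Finset V := fun i => {j | u i + w j = c i j}
      by_cases hall : ∀ S : Finset V, S.card ≤ (S.biUnion T).card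
      · obtain ⟨σ, hσ, hT⟩ := (Finset.all_card_le_biUnion_card_iff_exists_injective T).1 hall
        exact ⟨u, w, σ, huw, hσ, fun i => by simpa [T] using hT i⟩
      · push Not at hall
        obtain ⟨S, hS⟩ := hall
        let u' : V → ℤ := fun i => u i - if i ∈ S then 1 else 0
        let w' : V → ℤ := fun j => w j + if j ∈ S.biUnion T then 1 else 0
        have hfeas : ∀ i j, c i j ≤ u' i + w' j := by
          intro i j
          have hij := huw i j
          by_cases hi : i ∈ S
          · by_cases hj : j ∈ S.biUnion T
            · simp only [u', w', hi, hj, if_true]; lia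
            · have hne : u i + w j ≠ c i j := fun h =>
                hj (Finset.mem_biUnion.2 ⟨i, hi, by simpa [T] using h⟩)
              simp only [u', w', hi, hj, if_true, if_false]; lia
          · by_cases hj : j ∈ S.biUnion T
            · simp only [u', w', hi, hj, if_true, if_false]; lia
            · simp only [u', w', hi, hj, if_false]; lia
        have hu' : ∑ i, u' i = ∑ i, u i - S.card := by
          simp [u', Finset.sum_sub_distrib]
        have hw' : ∑ i, w' i = ∑ i, w i + (S.biUnion T).card := by
          simp only [w', Finset.sum_add_distrib, Finset.sum_boole, Finset.filter_univ_mem]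
        have hle : ∑ i, c i i ≤ ∑ i, u' i + ∑ i, w' i := by
          rw [← Finset.sum_add_distrib]
          exact Finset.sum_le_sum fun i _ => hfeas i i
        exact ih (∑ i, u' i + ∑ i, w' i - ∑ i, c i i).toNat (by lia) u' w' hfeas (by lia)
  let u : V → ℤ := fun i => ∑ j, |c i j|
  have hfeas : ∀ i j, c i j ≤ u i + (0 : V → ℤ) j := fun i j => by
    simpa using (le_abs_self _).trans
      (Finset.single_le_sum (f := fun j => |c i j|) (fun j _ => abs_nonneg _) (Finset.mem_univ j))
  have hle : ∑ i, c i i ≤ ∑ i, u i + ∑ i, (0 : V → ℤ) i := by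
    rw [← Finset.sum_add_distrib]
    exact Finset.sum_le_sum fun i _ => hfeas i i
  exact descent (∑ i, u i + ∑ i, (0 : V → ℤ) i - ∑ i, c i i).toNat u 0 hfeas (by lia)

/-- For a nonnegative matrix, the potentials in Egerváry's theorem can be taken nonnegative. -/
theorem exists_nonneg_potentials_tight_injective {V : Type*} [Fintype V] (c : V → V → ℤ)
    (hc : ∀ i j, 0 ≤ c i j) :
    ∃ (u w : V → ℤ) (σ : V → V), (∀ i, 0 ≤ u i) ∧ (∀ i, 0 ≤ w i) ∧
      (∀ i j, c i j ≤ u i + w j) ∧ Function.Injective σ ∧ ∀ i, u i + w (σ i) = c i (σ i) := by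
  obtain ⟨u, w, σ, huw, hσ, ht⟩ := exists_potentials_tight_injective c
  cases isEmpty_or_nonempty V
  · exact ⟨u, w, σ, isEmptyElim, isEmptyElim, huw, hσ, ht⟩
  · obtain ⟨j, hj⟩ := Finite.exists_min w
    refine ⟨fun i => u i + w j, fun i => w i - w j, σ, fun i => (hc i j).trans (huw i j),
      fun i => sub_nonneg.2 (hj i), fun i l => ?_, hσ, fun i => ?_⟩
    · have := huw i l
      lia
    · have := ht i
      lia

/-- The covering relation of the chains traced out by the increasing steps of `σ`. -/
def IncreasingStep {V : Type*} [LT V] (σ : V → V) (a b : V) : Prop := a < b ∧ σ a = b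

theorem IncreasingStep.reflTransGen_le {V : Type*} [Preorder V] {σ : V → V} {a b : V}
    (h : Relation.ReflTransGen (IncreasingStep σ) a b) : a ≤ b := by
  induction h with
  | refl => exact le_rfl
  | tail _ hbc ih => exact ih.trans hbc.1.le

theorem IncreasingStep.exists_terminal {V : Type*} [Finite V] [Preorder V] (σ : V → V) (a : V) :
    ∃ r, Relation.ReflTransGen (IncreasingStep σ) a r ∧ ¬ r < σ r := by
  induction a using (wellFounded_gt (α := V)).induction with
  | _ a ih =>
    by_cases ha : a < σ a
    · obtain ⟨r, hr, hr'⟩ := ih (σ a) ha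
      exact ⟨r, .head ⟨ha, rfl⟩ hr, hr'⟩
    · exact ⟨a, .refl, ha⟩

theorem IncreasingStep.total_of_injective {V : Type*} [LT V] {σ : V → V}
    (hσ : Function.Injective σ) {a b r : V} (ha : Relation.ReflTransGen (IncreasingStep σ) a r)
    (hb : Relation.ReflTransGen (IncreasingStep σ) b r) :
    Relation.ReflTransGen (IncreasingStep σ) a b ∨
      Relation.ReflTransGen (IncreasingStep σ) b a := by
  have hu : Relator.RightUnique (Function.swap (IncreasingStep σ)) :=
    fun x y z hy hz => hσ (hy.2.trans hz.2.symm)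
  have := Relation.ReflTransGen.total_of_right_unique hu
    (Relation.reflTransGen_swap.2 ha) (Relation.reflTransGen_swap.2 hb)
  exact this.symm.imp Relation.reflTransGen_swap.1 Relation.reflTransGen_swap.1

/-- An injective self-map `σ` of a finite poset yields a chain partition, indexed by the points
at which `σ` does not increase, in which the part of each fixed point is a singleton. -/
theorem exists_chain_partition_of_injective {V : Type*} [Fintype V] [DecidableEq V]
    [PartialOrder V] {σ : V → V} (hσ : Function.Injective σ) :
    ∃ D : V → Finset V, (∀ r, IsChain (· ≤ ·) (D r : Set V)) ∧
      (∀ r s, r ≠ s → Disjoint (D r) (D s)) ∧ (∀ v, ∃ r, v ∈ D r) ∧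
      (∀ r, r < σ r → D r = ∅) ∧ ∀ r, σ r = r → D r ⊆ {r} := by
  classical
  choose ρ hρ hterm using IncreasingStep.exists_terminal σ
  refine ⟨fun r => {v | ρ v = r}, fun r a ha b hb _ => ?_, fun r s hrs => ?_,
    fun v => ⟨ρ v, by simp⟩, fun r hr => ?_, fun r hr v hv => ?_⟩
  · simp only [Finset.coe_filter, Finset.mem_univ, true_and, Set.mem_ofPred_eq] at ha hb
    exact (IncreasingStep.total_of_injective hσ (ha ▸ hρ a) (hb ▸ hρ b)).imp
      IncreasingStep.reflTransGen_le IncreasingStep.reflTransGen_le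
  · rw [Finset.disjoint_left]
    intro v hv hv'
    simp only [Finset.mem_filter, Finset.mem_univ, true_and] at hv hv'
    exact hrs (hv.symm.trans hv')
  · refine Finset.filter_eq_empty_iff.2 fun v _ hv => hterm v ?_
    rwa [hv]
  · simp only [Finset.mem_filter, Finset.mem_univ, true_and] at hv
    have hvr := hv ▸ hρ v
    rw [Finset.mem_singleton]
    rcases hvr.cases_tail with h | ⟨a, _, ha, ha'⟩
    · exact h.symm
    · exact absurd (hσ (ha'.trans hr.symm)) ha.ne

/-- Weak duality: `k` antichains meet each chain `C` in at most `min |C| k` points. -/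
theorem card_biUnion_antichain_le_sum_min {V : Type*} [Fintype V] [DecidableEq V] [PartialOrder V]
    {k m : ℕ} {A : Fin k → Finset V} (hA : ∀ i, IsAntichain (· ≤ ·) (A i : Set V))
    {C : Fin m → Finset V} (hC : ∀ i, IsChain (· ≤ ·) (C i : Set V))
    (hcover : Finset.univ.biUnion C = Finset.univ) :
    (Finset.univ.biUnion A).card ≤ ∑ i, min (C i).card k := by
  have hsub : Finset.univ.biUnion A ⊆
      Finset.univ.biUnion fun i => C i ∩ Finset.univ.biUnion A := by
    rw [← Finset.biUnion_inter, hcover, Finset.univ_inter]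
  refine (Finset.card_le_card hsub).trans <| Finset.card_biUnion_le.trans <|
    Finset.sum_le_sum fun i _ => le_min (Finset.card_le_card Finset.inter_subset_left) ?_
  rw [Finset.inter_biUnion]
  calc (Finset.univ.biUnion fun j => C i ∩ A j).card
      ≤ ∑ _j : Fin k, 1 := Finset.card_biUnion_le.trans <| Finset.sum_le_sum fun j _ =>
        Finset.card_le_one.2 fun a ha b hb => by
          rw [Finset.mem_inter] at ha hb
          by_contra hab
          rcases hC i ha.1 hb.1 hab with h | h
          · exact hA j ha.2 hb.2 hab h
          · exact hA j hb.2 ha.2 (Ne.symm hab) h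
    _ = k := by simp

/-- Reindex a finite family of finsets by its nonempty members. -/
theorem exists_fin_nonempty_reindex {V ι : Type*} [Fintype ι] (D : ι → Finset V) (k : ℕ) :
    ∃ (m : ℕ) (e : Fin m → ι), Function.Injective e ∧ (∀ i, (D (e i)).Nonempty) ∧
      (∀ r, (D r).Nonempty → ∃ i, e i = r) ∧
      ∑ i, min (D (e i)).card k = ∑ r, min (D r).card k := by
  classical
  let S : Finset ι := {r | (D r).Nonempty}
  have hS : ∀ r, r ∈ S ↔ (D r).Nonempty := by simp [S]
  refine ⟨S.card, fun i => S.equivFin.symm i,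
    Subtype.val_injective.comp S.equivFin.symm.injective,
    fun i => (hS _).1 (S.equivFin.symm i).2,
    fun r hr => ⟨S.equivFin ⟨r, (hS r).2 hr⟩, by simp⟩, ?_⟩
  rw [Equiv.sum_comp S.equivFin.symm (fun r : S => min (D r).card k),
    Finset.sum_coe_sort S fun r => min (D r).card k]
  refine Finset.sum_subset (Finset.subset_univ S) fun r _ hr => ?_
  rw [hS, Finset.not_nonempty_iff_eq_empty] at hr
  simp [hr]

/-- Strong duality: some `k` disjoint antichains cover at least as many points as the `k`-norm of
some chain partition. -/
theorem exists_chain_partition_sum_min_le_card_antichains {V : Type*} [Fintype V] [DecidableEq V]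
    [PartialOrder V] {k : ℕ} (hk : 0 < k) :
    ∃ (A : Fin k → Finset V) (D : V → Finset V),
      (∀ i, IsAntichain (· ≤ ·) (A i : Set V)) ∧ (∀ i j, i ≠ j → Disjoint (A i) (A j)) ∧
      (∀ r, IsChain (· ≤ ·) (D r : Set V)) ∧ (∀ r s, r ≠ s → Disjoint (D r) (D s)) ∧
      (∀ v, ∃ r, v ∈ D r) ∧ ∑ r, min (D r).card k ≤ (Finset.univ.biUnion A).card := by
  classical
  let c : V → V → ℤ := fun i j => if i < j then k else if i = j then k - 1 else 0
  have hc : ∀ i j, 0 ≤ c i j := fun i j => by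
    simp only [c]
    split_ifs <;> lia
  obtain ⟨u, w, σ, hu, hw, huw, hσ, htight⟩ := exists_nonneg_potentials_tight_injective c hc
  obtain ⟨D, hchain, hdisj, hcover, hstep, hfix⟩ := exists_chain_partition_of_injective hσ
  let A : Fin k → Finset V := fun i => {v | w v = i ∧ u v + w v = k - 1}
  refine ⟨A, D, fun i a ha b hb hab hle => ?_, fun i j hij => ?_, hchain, hdisj, hcover, ?_⟩
  · simp only [A, Finset.coe_filter, Finset.mem_univ, true_and, Set.mem_ofPred_eq] at ha hb
    have := huw a b
    simp only [c, lt_of_le_of_ne hle hab, if_true] at this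
    lia
  · rw [Finset.disjoint_left]
    intro v hv hv'
    simp only [A, Finset.mem_filter, Finset.mem_univ, true_and] at hv hv'
    exact hij (Fin.ext (by lia))
  · have hnorm : ∀ r, ((min (D r).card k : ℕ) : ℤ) ≤ k - c r (σ r) := fun r => by
      simp only [c]
      split_ifs with h h'
      · simp [hstep r h]
      · have := Finset.card_le_card (hfix r h'.symm)
        rw [Finset.card_singleton] at this
        lia
      · lia
    have hunion : Finset.univ.biUnion A = ({v | u v + w v = k - 1} : Finset V) := by
      ext v
      simp only [A, Finset.mem_biUnion, Finset.mem_filter, Finset.mem_univ, true_and]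
      refine ⟨fun ⟨_, h⟩ => h.2, fun h => ?_⟩
      have := hu v
      have := hw v
      exact ⟨⟨(w v).toNat, by lia⟩, by simp only; lia, h⟩
    have hgain : ∀ v, k - (u v + w v) ≤ if u v + w v = k - 1 then (1 : ℤ) else 0 := fun v => by
      have := huw v v
      simp only [c, lt_irrefl, if_true, if_false] at this
      split_ifs <;> lia
    have hperm : ∑ r, w (σ r) = ∑ r, w r :=
      Function.Bijective.sum_comp (Finite.injective_iff_bijective.1 hσ) w
    have : ((∑ r, min (D r).card k : ℕ) : ℤ) ≤ (Finset.univ.biUnion A).card := by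
      rw [hunion]
      calc ((∑ r, min (D r).card k : ℕ) : ℤ)
          ≤ ∑ r, ((k : ℤ) - (u r + w (σ r))) := by
            rw [Nat.cast_sum]
            exact Finset.sum_le_sum fun r _ => htight r ▸ hnorm r
        _ = ∑ r, ((k : ℤ) - (u r + w r)) := by
            simp only [Finset.sum_sub_distrib, Finset.sum_add_distrib, hperm]
        _ ≤ ∑ v, if u v + w v = k - 1 then (1 : ℤ) else 0 :=
            Finset.sum_le_sum fun v _ => hgain v
        _ = _ := Finset.sum_boole _ _
    exact_mod_cast this

/-- **Greene–Kleitman theorem.** For every finite poset `V` and positive integer `k`,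
the maximum cardinality of the union of `k` pairwise disjoint antichains equals the
minimum, over all partitions of `V` into chains, of the `k`-norm `∑ min(|C|, k)`. -/
theorem greene_kleitman (V : Type) [Fintype V] [DecidableEq V] [PartialOrder V]
    (k : ℕ) (hk : 0 < k) :
    sSup {n : ℕ | ∃ A : Fin k → Finset V,
        (∀ i, IsAntichain (· ≤ ·) ((A i : Finset V) : Set V)) ∧
        (∀ i j, i ≠ j → Disjoint (A i) (A j)) ∧
        n = (Finset.univ.biUnion A).card} =
    sInf {n : ℕ | ∃ (m : ℕ) (C : Fin m → Finset V),
        (∀ i, IsChain (· ≤ ·) ((C i : Finset V) : Set V)) ∧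
        (∀ i, (C i).Nonempty) ∧
        (∀ i j, i ≠ j → Disjoint (C i) (C j)) ∧
        Finset.univ.biUnion C = Finset.univ ∧
        n = ∑ i, min (C i).card k} := by
  obtain ⟨A, D, hA, hAdisj, hD, hDdisj, hDcover, hle⟩ :=
    exists_chain_partition_sum_min_le_card_antichains (V := V) hk
  obtain ⟨m, e, he, hne, hsurj, hsum⟩ := exists_fin_nonempty_reindex D k
  have hcover : (Finset.univ.biUnion fun i => D (e i)) = Finset.univ := by
    refine Finset.eq_univ_iff_forall.2 fun v => ?_
    obtain ⟨r, hr⟩ := hDcover v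
    obtain ⟨i, rfl⟩ := hsurj r ⟨v, hr⟩
    exact Finset.mem_biUnion.2 ⟨i, Finset.mem_univ i, hr⟩
  apply le_antisymm
  · refine csSup_le ⟨_, A, hA, hAdisj, rfl⟩ ?_
    rintro _ ⟨A', hA', -, rfl⟩
    refine le_csInf ⟨_, m, fun i => D (e i), fun i => hD _, hne,
      fun i j hij => hDdisj _ _ (he.ne hij), hcover, rfl⟩ ?_
    rintro _ ⟨m', C, hC, -, -, hCcover, rfl⟩
    exact card_biUnion_antichain_le_sum_min hA' hC hCcover
  · refine le_trans (Nat.sInf_le ⟨m, fun i => D (e i), fun i => hD _, hne,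
      fun i j hij => hDdisj _ _ (he.ne hij), hcover, rfl⟩) ?_
    refine (hsum.le.trans hle).trans (le_csSup ⟨Fintype.card V, ?_⟩ ⟨A, hA, hAdisj, rfl⟩)
    rintro _ ⟨A', -, -, rfl⟩
    exact Finset.card_le_univ _
end

section
/- For every finite partially ordered set (V, ≤) and every positive integer k, the maximum cardinality of the union of k pairwise disjoint chains of V equals the minimum, over all partitions 𝒜 of V into antichains, of the k-norm Σ_{A∈𝒜} min(|A|, k). -/
open Finset Relation

/-- **Egerváry's theorem.** A minimum-cost perfect matching in a bipartite graph `R` with natural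
costs `w` that contains the diagonal is tight for some integral dual solution. -/
theorem exists_perm_tight_potentials {N : Type*} [Fintype N] (R : N → N → Prop)
    (hR : ∀ x, R x x) (w : N → N → ℕ) :
    ∃ (a b : N → ℤ) (σ : Equiv.Perm N), (∀ x y, R x y → a x + b y ≤ w x y) ∧
      ∀ x, R x (σ x) ∧ a x + b (σ x) = w x (σ x) := by
  classical
  obtain ⟨_, ⟨a, b, hab, rfl⟩, hmax⟩ := Int.exists_greatest_of_bdd
    (P := fun d => ∃ a b : N → ℤ, (∀ x y, R x y → a x + b y ≤ w x y) ∧ ∑ x, a x + ∑ x, b x = d)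
    ⟨∑ x, (w x x : ℤ), by
      rintro _ ⟨a, b, h, rfl⟩
      rw [← sum_add_distrib]
      exact sum_le_sum fun x _ => h x x (hR x)⟩
    ⟨0, 0, 0, by simp, by simp⟩
  let t : N → Finset N := fun x => {y | R x y ∧ a x + b y = w x y}
  have hall : ∀ s : Finset N, #s ≤ #(s.biUnion t) := by
    intro s
    by_contra! hlt
    have := hmax _ ⟨fun x => a x + if x ∈ s then 1 else 0,
      fun y => b y - if y ∈ s.biUnion t then 1 else 0, ?_, rfl⟩
    · simp only [sum_add_distrib, sum_sub_distrib, sum_boole, filter_mem_eq_inter, univ_inter]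
        at this
      omega
    · intro x y hxy
      have h := hab x y hxy
      by_cases hx : x ∈ s
      · by_cases hy : y ∈ s.biUnion t
        · simp only [hx, hy, if_true]
          omega
        · have : a x + b y ≠ w x y := fun he =>
            hy (mem_biUnion.2 ⟨x, hx, by simp [t, hxy, he]⟩)
          simp only [hx, hy, if_true, if_false]
          omega
      · simp only [hx, if_false]
        split_ifs <;> omega
  obtain ⟨f, hf, hft⟩ := (all_card_le_biUnion_card_iff_exists_injective t).1 hall
  refine ⟨a, b, Equiv.ofBijective f (Finite.injective_iff_bijective.1 hf), hab, fun x => ?_⟩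
  simpa [t] using hft x

/-- A permutation of `V ⊕ ι` which does not decrease elements of `V` yields disjoint chains of `V`,
indexed by `ι`, which cover all elements of `V` that it moves. -/
theorem exists_disjoint_chains_of_perm {V ι : Type*} [Fintype V] [PartialOrder V]
    (σ : Equiv.Perm (V ⊕ ι)) (hσ : ∀ u v, σ (.inl u) = .inl v → u ≤ v) :
    ∃ C : ι → Finset V, (∀ i, IsChain (· ≤ ·) (C i : Set V)) ∧
      (∀ i j, i ≠ j → Disjoint (C i) (C j)) ∧
      ∀ v, σ (.inl v) ≠ .inl v → ∃ i, v ∈ C i := by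
  classical
  let S : V → V → Prop := fun u v => σ (.inl u) = .inl v
  have hle : ∀ {u v}, ReflTransGen S u v → u ≤ v := by
    intro u v h
    induction h with
    | refl => exact le_rfl
    | tail _ h ih => exact ih.trans (hσ _ _ h)
  refine ⟨fun i => {v | ∃ u, σ (.inr i) = .inl u ∧ ReflTransGen S u v}, ?_, ?_, ?_⟩
  · intro i v hv v' hv' _
    simp only [coe_filter, mem_univ, true_and, Set.mem_ofPred_eq] at hv hv'
    obtain ⟨u, hu, huv⟩ := hv
    obtain ⟨u', hu', huv'⟩ := hv'
    obtain rfl : u = u' := Sum.inl_injective (hu.symm.trans hu')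
    exact (ReflTransGen.total_of_right_unique
      (fun _ _ _ h h' => Sum.inl_injective (h.symm.trans h')) huv huv').imp hle hle
  · intro i j hij
    rw [Finset.disjoint_left]
    intro v hv hv'
    simp only [mem_filter, mem_univ, true_and] at hv hv'
    obtain ⟨u, hu, huv⟩ := hv
    obtain ⟨u', hu', huv'⟩ := hv'
    apply hij
    induction huv with
    | refl =>
      rcases huv'.cases_tail with rfl | ⟨c, _, hc⟩
      · exact Sum.inr_injective (σ.injective (hu.trans hu'.symm))
      · exact absurd (σ.injective (hu.trans hc.symm)) (by simp)
    | tail _ h ih =>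
      rcases huv'.cases_tail with rfl | ⟨c, hc, hcv⟩
      · exact absurd (σ.injective (h.trans hu'.symm)) (by simp)
      · obtain rfl := Sum.inl_injective (σ.injective (h.trans hcv.symm))
        exact ih hc
  · intro v
    induction v using WellFoundedLT.induction with
    | ind v ih =>
      intro hv
      rcases hx : σ.symm (.inl v) with u | i
      · rw [Equiv.symm_apply_eq] at hx
        have hne : u ≠ v := by
          rintro rfl
          exact hv hx.symm
        obtain ⟨i, hi⟩ := ih u (lt_of_le_of_ne (hσ _ _ hx.symm) hne)
          (by rw [← hx]; simpa using hne.symm)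
        simp only [mem_filter, mem_univ, true_and] at hi ⊢
        obtain ⟨c, hc, hcu⟩ := hi
        exact ⟨i, c, hc, hcu.tail hx.symm⟩
      · rw [Equiv.symm_apply_eq] at hx
        refine ⟨i, ?_⟩
        simp only [mem_filter, mem_univ, true_and]
        exact ⟨v, hx.symm, .refl⟩

/-- A union of `k` chains has at most as many elements as the `k`-norm of an antichain cover. -/
theorem card_biUnion_chains_le_sum_min {V ι : Type*} [Fintype V] [DecidableEq V] [PartialOrder V]
    [Fintype ι] {k : ℕ} (C : Fin k → Finset V) (A : ι → Finset V)
    (hC : ∀ i, IsChain (· ≤ ·) (C i : Set V)) (hA : ∀ i, IsAntichain (· ≤ ·) (A i : Set V))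
    (hcover : univ.biUnion A = univ) :
    #(univ.biUnion C) ≤ ∑ i, min #(A i) k := by
  calc #(univ.biUnion C) ≤ #(univ.biUnion fun i => A i ∩ univ.biUnion C) := by
        rw [← biUnion_inter, hcover, univ_inter]
    _ ≤ ∑ i, #(A i ∩ univ.biUnion C) := card_biUnion_le
    _ ≤ ∑ i, min #(A i) k := sum_le_sum fun i _ => le_min (card_le_card inter_subset_left) ?_
  rw [inter_biUnion]
  refine (card_biUnion_le_card_mul _ _ 1 fun j _ => card_le_one.2 ?_).trans (by simp)
  intro u hu v hv
  rw [mem_inter] at hu hv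
  by_contra hne
  rcases hC j hu.2 hv.2 hne with h | h
  · exact hA i hu.1 hv.1 hne h
  · exact hA i hv.1 hu.1 (Ne.symm hne) h

/-- The fibres of a map, indexed by the elements of its image. -/
theorem exists_antichain_partition_of_fibers {V β : Type*} [Fintype V] [DecidableEq V]
    [PartialOrder V] [DecidableEq β] (f : V → β) (hf : ∀ u v, u < v → f u ≠ f v) (k : ℕ) :
    ∃ (m : ℕ) (A : Fin m → Finset V),
      (∀ i, IsAntichain (· ≤ ·) (A i : Set V)) ∧ (∀ i, (A i).Nonempty) ∧
      (∀ i j, i ≠ j → Disjoint (A i) (A j)) ∧ univ.biUnion A = univ ∧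
      ∑ i, min #(A i) k = ∑ c ∈ univ.image f, min #{v | f v = c} k := by
  let e := (univ.image f).equivFin
  refine ⟨#(univ.image f), fun i => {v | f v = e.symm i}, ?_, ?_, ?_, ?_, ?_⟩
  · intro i u hu v hv hne hle
    simp only [coe_filter, mem_univ, true_and, Set.mem_ofPred_eq] at hu hv
    exact hf u v (lt_of_le_of_ne hle hne) (hu.trans hv.symm)
  · intro i
    obtain ⟨v, -, hv⟩ := mem_image.1 (e.symm i).2
    exact ⟨v, by simp [hv]⟩
  · intro i j hij
    rw [Finset.disjoint_left]
    intro v hv hv'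
    simp only [mem_filter, mem_univ, true_and] at hv hv'
    exact hij (e.symm.injective (Subtype.ext (hv.symm.trans hv')))
  · ext v
    simp only [mem_biUnion, mem_filter, mem_univ, true_and, iff_true]
    exact ⟨e ⟨f v, mem_image_of_mem f (mem_univ v)⟩, by simp⟩
  · rw [Equiv.sum_comp e.symm fun c : univ.image f => min #{v | f v = (c : β)} k]
    exact sum_coe_sort (univ.image f) fun c => min #{v | f v = c} k

/-- Potentials on the two copies of `V`, bounded by `α` and `β`, yield a partition into antichains
of `k`-norm at most the value of the dual solution. -/
theorem exists_antichain_partition_of_potentials {V : Type*} [Fintype V] [DecidableEq V]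
    [PartialOrder V] (k : ℕ) (a b : V → ℤ) (α β : ℤ) (hαβ : α + β ≤ 0)
    (hlt : ∀ u v, u < v → a u + b v ≤ 0) (hself : ∀ v, a v + b v ≤ 1)
    (ha : ∀ v, a v + β ≤ 0) (hb : ∀ v, α + b v ≤ 0) :
    ∃ (m : ℕ) (A : Fin m → Finset V),
      (∀ i, IsAntichain (· ≤ ·) (A i : Set V)) ∧ (∀ i, (A i).Nonempty) ∧
      (∀ i j, i ≠ j → Disjoint (A i) (A j)) ∧ univ.biUnion A = univ ∧
      (∑ i, min #(A i) k : ℕ) ≤ k * -(α + β) + ∑ v, (1 - a v - b v) := by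
  let f : V → ℤ ⊕ V := fun v => if a v + b v = 1 then .inl (a v) else .inr v
  obtain ⟨m, A, h₁, h₂, h₃, h₄, h₅⟩ := exists_antichain_partition_of_fibers f (k := k) <| by
    intro u v huv h
    have := hlt u v huv
    simp only [f] at h
    split_ifs at h with hu hv
    · have := Sum.inl_injective h
      omega
    · exact huv.ne (Sum.inr_injective h)
  refine ⟨m, A, h₁, h₂, h₃, h₄, ?_⟩
  rw [h₅]
  let L : Finset V := {v | a v + b v ≠ 1}
  have hsub : univ.image f ⊆ (Ioc α (-β)).disjSum L := by
    intro c hc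
    obtain ⟨v, -, rfl⟩ := mem_image.1 hc
    have := ha v
    have := hb v
    by_cases hv : a v + b v = 1
    · simp only [f, hv, if_true, inl_mem_disjSum, mem_Ioc]
      omega
    · simp [f, hv, L]
  have hinr : ∀ v, #{u | f u = .inr v} ≤ 1 := by
    intro v
    rw [card_le_one]
    have key : ∀ u, f u = .inr v → u = v := by
      intro u hu
      simp only [f] at hu
      split_ifs at hu
      exact Sum.inr_injective hu
    intro u hu u' hu'
    simp only [mem_filter, mem_univ, true_and] at hu hu'
    rw [key u hu, key u' hu']
  have hcard : ∑ c ∈ univ.image f, min #{v | f v = c} k ≤ #(Ioc α (-β)) * k + #L :=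
    calc _ ≤ ∑ c ∈ (Ioc α (-β)).disjSum L, min #{v | f v = c} k := sum_le_sum_of_subset hsub
      _ = ∑ c ∈ Ioc α (-β), min #{v | f v = .inl c} k + ∑ c ∈ L, min #{v | f v = .inr c} k :=
        sum_disjSum _ _ _
      _ ≤ #(Ioc α (-β)) * k + #L := by
        refine add_le_add ?_ ?_
        · exact sum_le_card_nsmul _ _ _ fun _ _ => min_le_right _ _
        · exact (sum_le_card_nsmul _ _ 1 fun v _ => (min_le_left _ _).trans (hinr v)).trans
            (by simp)
  have hL : (#L : ℤ) ≤ ∑ v, (1 - a v - b v) := by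
    rw [card_filter, Nat.cast_sum]
    refine sum_le_sum fun v _ => ?_
    have := hself v
    split_ifs <;> push_cast <;> omega
  have hT : (#(Ioc α (-β)) : ℤ) = -(α + β) := by
    rw [Int.card_Ioc]
    omega
  zify at hcard
  rw [hT] at hcard
  push_cast
  linarith

/-- Some `k` disjoint chains cover as many elements as the `k`-norm of some antichain partition. -/
theorem exists_chains_antichain_partition {V : Type*} [Fintype V] [DecidableEq V]
    [PartialOrder V] (k : ℕ) (hk : 0 < k) :
    ∃ (C : Fin k → Finset V) (m : ℕ) (A : Fin m → Finset V),
      ((∀ i, IsChain (· ≤ ·) (C i : Set V)) ∧ ∀ i j, i ≠ j → Disjoint (C i) (C j)) ∧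
      ((∀ i, IsAntichain (· ≤ ·) (A i : Set V)) ∧ (∀ i, (A i).Nonempty) ∧
        (∀ i j, i ≠ j → Disjoint (A i) (A j)) ∧ univ.biUnion A = univ) ∧
      ∑ i, min #(A i) k ≤ #(univ.biUnion C) := by
  have : Nonempty (Fin k) := ⟨⟨0, hk⟩⟩
  let R : V ⊕ Fin k → V ⊕ Fin k → Prop := fun x y => ∀ u v, x = .inl u → y = .inl v → u ≤ v
  let w : V ⊕ Fin k → V ⊕ Fin k → ℕ := fun x y => if x = y ∧ x.isLeft then 1 else 0
  obtain ⟨a, b, σ, hab, hσ⟩ := exists_perm_tight_potentials R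
    (by rintro x u v rfl h; exact (Sum.inl_injective h).le) w
  obtain ⟨C, hC, hCd, hCm⟩ := exists_disjoint_chains_of_perm σ
    fun u v h => (hσ (.inl u)).1 u v rfl h
  obtain ⟨i₀, hi₀⟩ := Finite.exists_max fun i => a (.inr i)
  obtain ⟨j₀, hj₀⟩ := Finite.exists_max fun j => b (.inr j)
  obtain ⟨m, A, h₁, h₂, h₃, h₄, h₅⟩ := exists_antichain_partition_of_potentials k
    (fun v => a (.inl v)) (fun v => b (.inl v)) (a (.inr i₀)) (b (.inr j₀))
    (by simpa [w] using hab (.inr i₀) (.inr j₀) (by simp [R]))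
    (fun u v h => by simpa [w, h.ne] using hab (.inl u) (.inl v) (by simpa [R] using h.le))
    (fun v => by simpa [w] using hab (.inl v) (.inl v) (by simp [R]))
    (fun v => by simpa [w] using hab (.inl v) (.inr j₀) (by simp [R]))
    (fun v => by simpa [w] using hab (.inr i₀) (.inl v) (by simp [R]))
  refine ⟨C, m, A, ⟨hC, hCd⟩, ⟨h₁, h₂, h₃, h₄⟩, ?_⟩
  have hdual : ∑ x, a x + ∑ x, b x = ∑ x, (w x (σ x) : ℤ) := by
    rw [← Equiv.sum_comp σ b, ← sum_add_distrib]
    exact sum_congr rfl fun x _ => (hσ x).2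
  have hk' : ∑ i, a (.inr i) + ∑ i, b (.inr i) ≤ k * (a (.inr i₀) + b (.inr j₀)) := by
    rw [← sum_add_distrib]
    exact (sum_le_card_nsmul _ _ _ fun i _ => add_le_add (hi₀ i) (hj₀ i)).trans (by simp)
  have hcov : ∑ v : V, (1 - (w (.inl v) (σ (.inl v)) : ℤ)) ≤ #(univ.biUnion C) := by
    have : #{v : V | σ (.inl v) ≠ .inl v} ≤ #(univ.biUnion C) := card_le_card fun v hv => by
      simpa using hCm v (by simpa using hv)
    refine le_trans ?_ (Nat.cast_le.2 this)
    rw [card_filter, Nat.cast_sum]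
    refine sum_le_sum fun v _ => ?_
    by_cases h : σ (.inl v) = .inl v
    · simp [w, h]
    · simp [w, h, Ne.symm h]
  have hw : ∀ i, w (.inr i) (σ (.inr i)) = 0 := by simp [w]
  simp only [Fintype.sum_sum_type, hw, Nat.cast_zero, sum_const_zero, add_zero] at hdual
  simp only [sum_sub_distrib] at hcov h₅
  zify
  push_cast at h₅
  linarith


/-- **Dual Greene–Kleitman (Greene's) theorem.** For every finite poset `V` and positive
integer `k`, the maximum cardinality of the union of `k` pairwise disjoint chains equals
the minimum, over all partitions of `V` into antichains, of the `k`-norm `∑ min(|A|, k)`. -/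
theorem greene_kleitman_dual (V : Type) [Fintype V] [DecidableEq V] [PartialOrder V]
    (k : ℕ) (hk : 0 < k) :
    sSup {n : ℕ | ∃ C : Fin k → Finset V,
        (∀ i, IsChain (· ≤ ·) ((C i : Finset V) : Set V)) ∧
        (∀ i j, i ≠ j → Disjoint (C i) (C j)) ∧
        n = (Finset.univ.biUnion C).card} =
    sInf {n : ℕ | ∃ (m : ℕ) (A : Fin m → Finset V),
        (∀ i, IsAntichain (· ≤ ·) ((A i : Finset V) : Set V)) ∧
        (∀ i, (A i).Nonempty) ∧
        (∀ i j, i ≠ j → Disjoint (A i) (A j)) ∧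
        Finset.univ.biUnion A = Finset.univ ∧
        n = ∑ i, min (A i).card k} := by
  obtain ⟨C, m, A, ⟨hC, hCd⟩, ⟨hA, hAn, hAd, hAu⟩, hle⟩ :=
    exists_chains_antichain_partition (V := V) k hk
  refine le_antisymm ?_ ?_
  · refine csSup_le ⟨_, C, hC, hCd, rfl⟩ ?_
    rintro _ ⟨C', hC', -, rfl⟩
    refine le_csInf ⟨_, m, A, hA, hAn, hAd, hAu, rfl⟩ ?_
    rintro _ ⟨m', A', hA', -, -, hAu', rfl⟩
    exact card_biUnion_chains_le_sum_min C' A' hC' hA' hAu'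
  · refine le_trans (Nat.sInf_le ⟨m, A, hA, hAn, hAd, hAu, rfl⟩) (hle.trans ?_)
    refine le_csSup ⟨Fintype.card V, ?_⟩ ⟨C, hC, hCd, rfl⟩
    rintro _ ⟨C', -, -, rfl⟩
    exact card_le_univ _
end

section
/- For every finite partially ordered set (V, ≤) and every positive integer k, the maximum cardinality of the union of k pairwise disjoint antichains of V equals the minimum, over all finite families 𝒫 of chains (the chains may overlap and are counted with multiplicity), of |V ∖ ⋃𝒫| + k·|𝒫|. -/
/-- **Egerváry's theorem**: an integral cost matrix has an optimal assignment together with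
integral dual potentials that certify its optimality. -/
theorem exists_perm_potentials {ι : Type*} [Fintype ι] [DecidableEq ι] (c : ι → ι → ℤ) :
    ∃ (p q : ι → ℤ) (σ : Equiv.Perm ι),
      (∀ i j, p i + q j ≤ c i j) ∧ ∀ i, p i + q (σ i) = c i (σ i) := by
  obtain ⟨z, ⟨p, q, hpq, rfl⟩, hmax⟩ := Int.exists_greatest_of_bdd
    (P := fun z => ∃ p q : ι → ℤ, (∀ i j, p i + q j ≤ c i j) ∧ ∑ i, p i + ∑ i, q i = z)
    ⟨∑ i, c i i, by
      rintro _ ⟨p, q, h, rfl⟩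
      rw [← Finset.sum_add_distrib]
      exact Finset.sum_le_sum fun i _ => h i i⟩
    ⟨_, fun i => -∑ j, |c i j|, 0, fun i j => by
      have h := Finset.single_le_sum (f := fun j => |c i j|) (fun _ _ => abs_nonneg _)
        (Finset.mem_univ j)
      have h' := neg_abs_le (c i j)
      simp only [Pi.zero_apply] at h ⊢
      linarith, rfl⟩
  let N : ι → Finset ι := fun i => Finset.univ.filter fun j => p i + q j = c i j
  have hall : ∀ X : Finset ι, X.card ≤ (X.biUnion N).card := by
    intro X
    by_contra! hX
    let Y := X.biUnion N
    have h := hmax _ ⟨fun i => p i + if i ∈ X then 1 else 0,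
      fun j => q j - if j ∈ Y then 1 else 0, fun i j => by
        have hij := hpq i j
        by_cases hi : i ∈ X <;> by_cases hj : j ∈ Y <;> simp only [hi, hj, if_true, if_false]
        · omega
        · have hne : p i + q j ≠ c i j := fun heq =>
            hj (Finset.mem_biUnion.2 ⟨i, hi, by simp [N, heq]⟩)
          omega
        · omega
        · omega, rfl⟩
    simp only [Finset.sum_add_distrib, Finset.sum_sub_distrib, Finset.sum_ite_mem,
      Finset.univ_inter, Finset.sum_const, nsmul_eq_mul, mul_one] at h
    have hX' : (Y.card : ℤ) < X.card := by exact_mod_cast hX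
    linarith
  obtain ⟨f, hf, hfN⟩ := (Finset.all_card_le_biUnion_card_iff_exists_injective N).1 hall
  refine ⟨p, q, Equiv.ofBijective f (Finite.injective_iff_bijective.1 hf), hpq, fun i => ?_⟩
  simpa [N] using hfN i

section ChainCost

variable {V : Type*} [Fintype V] [DecidableEq V] [PartialOrder V]

open Classical in
/-- Assignment costs on `V ⊕ V`, whose second summand serves as a supply of terminals. A cheap
permutation encodes a chain family: leaving a terminal starts a chain at cost `k`, and a fixed
element of `V` is left uncovered at cost `1`. The cost `|V| + 1` marks a forbidden transition. -/
noncomputable def chainCost (k : ℕ) : V ⊕ V → V ⊕ V → ℤ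
  | .inl v, .inl w => if v = w then 1 else if v < w then 0 else Fintype.card V + 1
  | .inl _, .inr _ => 0
  | .inr _, .inl _ => k
  | .inr _, .inr _ => 0

theorem chainCost_nonneg (k : ℕ) (x y : V ⊕ V) : 0 ≤ chainCost k x y := by
  rcases x with v | s <;> rcases y with w | t <;> simp only [chainCost]
  · split_ifs <;> positivity
  · exact le_rfl
  · positivity
  · exact le_rfl

theorem sum_chainCost_self (k : ℕ) :
    ∑ x : V ⊕ V, chainCost k x x = Fintype.card V := by
  simp [Fintype.sum_sum_type, chainCost]

/-- Potentials for `chainCost` yield disjoint antichains covering at least their total value. -/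
theorem exists_antichains_of_potentials (k : ℕ) (p q : V ⊕ V → ℤ)
    (h : ∀ x y, p x + q y ≤ chainCost k x y) :
    ∃ A : Fin k → Finset V, (∀ i, IsAntichain (· ≤ ·) (A i : Set V)) ∧
      (∀ i j, i ≠ j → Disjoint (A i) (A j)) ∧
      ∑ x, p x + ∑ x, q x ≤ (Finset.univ.biUnion A).card := by
  rcases isEmpty_or_nonempty V with hV | hV
  · exact ⟨fun _ => ∅, by simp, by simp, by simp⟩
  obtain ⟨s, hs⟩ := Finite.exists_max fun s : V => p (.inr s)
  obtain ⟨t, ht⟩ := Finite.exists_max fun t : V => q (.inr t)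
  let a : V → ℤ := fun v => p (.inl v) + q (.inr t)
  let b : V → ℤ := fun v => q (.inl v) + p (.inr s)
  have ha : ∀ v, a v ≤ 0 := fun v => h (.inl v) (.inr t)
  have hb : ∀ v, b v ≤ k := fun v => by
    have := h (.inr s) (.inl v)
    simp only [chainCost] at this
    simp only [b]; linarith
  have hst : p (.inr s) + q (.inr t) ≤ 0 := h (.inr s) (.inr t)
  have hab : ∀ v, a v + b v ≤ 1 := fun v => by
    have := h (.inl v) (.inl v)
    simp only [chainCost, if_true] at this
    simp only [a, b]; linarith
  have hlt : ∀ v w, v < w → a v + b w ≤ 0 := fun v w hvw => by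
    have := h (.inl v) (.inl w)
    simp only [chainCost, if_neg hvw.ne, if_pos hvw] at this
    simp only [a, b]; linarith
  have hsum : ∑ x, p x + ∑ x, q x ≤ ∑ v, (a v + b v) := by
    have h₁ := Finset.sum_le_sum fun v (_ : v ∈ Finset.univ) => hs v
    have h₂ := Finset.sum_le_sum fun v (_ : v ∈ Finset.univ) => ht v
    simp only [Fintype.sum_sum_type, a, b, Finset.sum_add_distrib] at *
    linarith
  refine ⟨fun i => Finset.univ.filter fun v => a v + b v = 1 ∧ b v = i + 1, ?_, ?_, ?_⟩
  · intro i v hv w hw hne hle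
    simp only [Finset.coe_filter, Finset.mem_univ, true_and, Set.mem_ofPred_eq] at hv hw
    have := hlt v w (lt_of_le_of_ne hle hne)
    omega
  · intro i j hij
    refine Finset.disjoint_left.2 fun v hv hw => hij (Fin.ext ?_)
    simp only [Finset.mem_filter, Finset.mem_univ, true_and] at hv hw
    omega
  · refine hsum.trans ?_
    calc ∑ v, (a v + b v) ≤ ∑ v, if a v + b v = 1 then (1 : ℤ) else 0 := by
          refine Finset.sum_le_sum fun v _ => ?_
          have := hab v
          split_ifs <;> omega
      _ = ((Finset.univ.filter fun v => a v + b v = 1).card : ℤ) := by simp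
      _ ≤ _ := by
          refine Nat.cast_le.2 (Finset.card_le_card fun v hv => ?_)
          simp only [Finset.mem_filter, Finset.mem_univ, true_and, Finset.mem_biUnion] at hv ⊢
          have h₁ := ha v
          have h₂ := hb v
          exact ⟨⟨(b v - 1).toNat, by omega⟩, hv, by simp only; omega⟩

/-- A permutation of `V ⊕ V` without forbidden transitions decomposes into chains. -/
theorem exists_chains_of_perm (k : ℕ) (σ : Equiv.Perm (V ⊕ V))
    (hσ : ∀ x, chainCost k x (σ x) ≤ Fintype.card V) :
    ∃ (m : ℕ) (P : Fin m → Finset V), (∀ i, IsChain (· ≤ ·) (P i : Set V)) ∧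
      ((Finset.univ \ Finset.univ.biUnion P).card + k * m : ℤ) ≤
        ∑ x, chainCost k x (σ x) := by
  classical
  have hstep : ∀ v w, σ (.inl v) = .inl w → v ≤ w := by
    intro v w hvw
    have := hσ (.inl v)
    rw [hvw] at this
    by_contra hle
    simp only [chainCost, if_neg (fun h : v = w => hle h.le),
      if_neg (fun h : v < w => hle h.le)] at this
    omega
  let R : V → V → Prop := fun v w => σ (.inl v) = .inl w
  let S : Finset V := Finset.univ.filter fun s => ∃ w, σ (.inr s) = .inl w
  let C : V → Finset V := fun s =>
    Finset.univ.filter fun v => ∃ w, σ (.inr s) = .inl w ∧ Relation.ReflTransGen R w v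
  have hR : ∀ v w, Relation.ReflTransGen R v w → v ≤ w := by
    intro v w hvw
    induction hvw with
    | refl => exact le_rfl
    | tail _ h ih => exact ih.trans (hstep _ _ h)
  have hC : ∀ s, IsChain (· ≤ ·) (C s : Set V) := by
    intro s v hv w hw _
    simp only [C, Finset.coe_filter, Finset.mem_univ, true_and, Set.mem_ofPred_eq] at hv hw
    obtain ⟨u, hu, huv⟩ := hv
    obtain ⟨u', hu', huw⟩ := hw
    obtain rfl : u = u' := Sum.inl_injective (hu.symm.trans hu')
    exact (Relation.ReflTransGen.total_of_right_unique
      (fun _ _ _ h h' => Sum.inl_injective (h.symm.trans h')) huv huw).imp (hR _ _) (hR _ _)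
  have hcov : ∀ v, σ (.inl v) ≠ .inl v → ∃ s ∈ S, v ∈ C s := by
    intro v
    induction v using WellFoundedLT.induction with
    | ind v ih =>
      intro hv
      rcases hu : σ.symm (.inl v) with u | s
      · have huv : σ (.inl u) = .inl v := by rw [← hu, Equiv.apply_symm_apply]
        have hne : u ≠ v := by rintro rfl; exact hv huv
        obtain ⟨s, hs, hus⟩ := ih u (lt_of_le_of_ne (hstep _ _ huv) hne)
          (fun h => hne (Sum.inl_injective (h.symm.trans huv)))
        simp only [C, Finset.mem_filter, Finset.mem_univ, true_and] at hus ⊢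
        obtain ⟨w, hw, hwu⟩ := hus
        exact ⟨s, hs, w, hw, hwu.tail huv⟩
      · have hsv : σ (.inr s) = .inl v := by rw [← hu, Equiv.apply_symm_apply]
        exact ⟨s, by simp [S, hsv], by simp [C, hsv, Relation.ReflTransGen.refl]⟩
  refine ⟨S.card, fun i => C (S.equivFin.symm i), fun i => hC _, ?_⟩
  have hunc : (Finset.univ \ Finset.univ.biUnion fun i => C (S.equivFin.symm i)) ⊆
      Finset.univ.filter fun v => σ (.inl v) = .inl v := by
    intro v hv
    simp only [Finset.mem_sdiff, Finset.mem_univ, true_and, Finset.mem_biUnion,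
      Finset.mem_filter, not_exists] at hv ⊢
    by_contra hne
    obtain ⟨s, hs, hvs⟩ := hcov v hne
    exact hv (S.equivFin ⟨s, hs⟩) (by simpa using hvs)
  rw [Fintype.sum_sum_type]
  refine add_le_add ((Nat.cast_le.2 (Finset.card_le_card hunc)).trans ?_) ?_
  · rw [Finset.card_filter, Nat.cast_sum]
    refine Finset.sum_le_sum fun v _ => ?_
    split_ifs with hv
    · simp [hv, chainCost]
    · exact_mod_cast chainCost_nonneg k _ _
  · rw [Finset.card_filter, Nat.cast_sum, Finset.mul_sum]
    refine Finset.sum_le_sum fun s _ => ?_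
    split_ifs with hs
    · obtain ⟨w, hw⟩ := hs
      simp [hw, chainCost]
    · simpa using chainCost_nonneg k _ _

end ChainCost

/-- Weak duality: the union of `k` antichains is no larger than the `k`-norm of a chain family. -/
theorem card_biUnion_antichains_le {V : Type*} [Fintype V] [DecidableEq V] [PartialOrder V]
    {k m : ℕ} (A : Fin k → Finset V) (P : Fin m → Finset V)
    (hA : ∀ i, IsAntichain (· ≤ ·) (A i : Set V)) (hP : ∀ i, IsChain (· ≤ ·) (P i : Set V)) :
    (Finset.univ.biUnion A).card ≤ (Finset.univ \ Finset.univ.biUnion P).card + k * m := by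
  have hsub : Finset.univ.biUnion A ⊆ (Finset.univ \ Finset.univ.biUnion P) ∪
      Finset.univ.biUnion fun ij : Fin k × Fin m => A ij.1 ∩ P ij.2 := by
    intro v hv
    simp only [Finset.mem_biUnion, Finset.mem_univ, true_and, Finset.mem_union,
      Finset.mem_sdiff, Finset.mem_inter, Prod.exists] at hv ⊢
    obtain ⟨i, hi⟩ := hv
    by_cases h : ∃ j, v ∈ P j
    · exact .inr ⟨i, h.choose, hi, h.choose_spec⟩
    · exact .inl h
  refine (Finset.card_le_card hsub).trans ((Finset.card_union_le _ _).trans ?_)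
  refine Nat.add_le_add_left ((Finset.card_biUnion_le_card_mul _ _ 1 fun ij _ => ?_).trans ?_) _
  · refine Finset.card_le_one.2 fun v hv w hw => ?_
    rw [Finset.mem_inter] at hv hw
    by_contra hne
    rcases hP ij.2 hv.2 hw.2 hne with h | h
    · exact hA ij.1 hv.1 hw.1 hne h
    · exact hA ij.1 hw.1 hv.1 (Ne.symm hne) h
  · simp


/-- **Schrijver's form of the Greene–Kleitman theorem.** For every finite poset `V` and
positive integer `k`, the maximum cardinality of the union of `k` pairwise disjoint
antichains equals the minimum, over all finite families `P` of chains (possibly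
overlapping, counted with multiplicity, here indexed by `Fin m`), of
`|V \ ⋃ P| + k * |P|`. -/
theorem greene_kleitman_schrijver (V : Type) [Fintype V] [DecidableEq V] [PartialOrder V]
    (k : ℕ) (hk : 0 < k) :
    sSup {n : ℕ | ∃ A : Fin k → Finset V,
        (∀ i, IsAntichain (· ≤ ·) ((A i : Finset V) : Set V)) ∧
        (∀ i j, i ≠ j → Disjoint (A i) (A j)) ∧
        n = (Finset.univ.biUnion A).card} =
    sInf {n : ℕ | ∃ (m : ℕ) (P : Fin m → Finset V),
        (∀ i, IsChain (· ≤ ·) ((P i : Finset V) : Set V)) ∧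
        n = (Finset.univ \ Finset.univ.biUnion P).card + k * m} := by
  obtain ⟨p, q, σ, hpq, hσ⟩ := exists_perm_potentials (chainCost (V := V) k)
  have hval : ∑ x, chainCost k x (σ x) = ∑ x, p x + ∑ x, q x := by
    rw [← Equiv.sum_comp σ q, ← Finset.sum_add_distrib]
    exact Finset.sum_congr rfl fun x _ => (hσ x).symm
  have hle : ∑ x, chainCost k x (σ x) ≤ Fintype.card V := by
    rw [hval, ← Finset.sum_add_distrib, ← sum_chainCost_self k]
    exact Finset.sum_le_sum fun x _ => hpq x x
  obtain ⟨A, hA, hAd, hAcard⟩ := exists_antichains_of_potentials k p q hpq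
  obtain ⟨m, P, hP, hPcard⟩ := exists_chains_of_perm k σ fun x =>
    (Finset.single_le_sum (fun y _ => chainCost_nonneg k y (σ y)) (Finset.mem_univ x)).trans hle
  have hPA : (Finset.univ \ Finset.univ.biUnion P).card + k * m ≤
      (Finset.univ.biUnion A).card := by
    exact_mod_cast hPcard.trans (hval.trans_le hAcard)
  apply le_antisymm
  · refine csSup_le ⟨_, A, hA, hAd, rfl⟩ ?_
    rintro _ ⟨A', hA', -, rfl⟩
    refine le_csInf ⟨_, m, P, hP, rfl⟩ ?_
    rintro _ ⟨m', P', hP', rfl⟩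
    exact card_biUnion_antichains_le A' P' hA' hP'
  · refine le_trans (Nat.sInf_le ⟨m, P, hP, rfl⟩) (hPA.trans (le_csSup ⟨Fintype.card V, ?_⟩
      ⟨A, hA, hAd, rfl⟩))
    rintro _ ⟨A', -, -, rfl⟩
    exact Finset.card_le_univ _
end

section
/- For every finite partially ordered set (V, ≤) and every positive integer k, the maximum cardinality of the union of k pairwise disjoint chains of V equals the minimum, over all finite families 𝒜 of pairwise disjoint antichains, of |V ∖ ⋃𝒜| + k·|𝒜|. -/
/-- **Egerváry's theorem** for bipartite graphs containing the identity matching: some perfect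
matching is tight for some integral dual solution. -/
theorem exists_perm_tight_dual {α : Type*} [Fintype α] (E : α → α → Prop) (hE : ∀ x, E x x)
    (w : α → α → ℤ) :
    ∃ (a b : α → ℤ) (σ : Equiv.Perm α), (∀ x y, E x y → w x y ≤ a x + b y) ∧
      ∀ x, E x (σ x) ∧ a x + b (σ x) = w x (σ x) := by
  classical
  obtain ⟨s, ⟨a, b, hab, rfl⟩, hmin⟩ := Int.exists_least_of_bdd
    (P := fun s => ∃ a b : α → ℤ, (∀ x y, E x y → w x y ≤ a x + b y) ∧ s = ∑ x, (a x + b x))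
    ⟨∑ x, w x x, by
      rintro _ ⟨a, b, hab, rfl⟩
      exact Finset.sum_le_sum fun x _ => hab x x (hE x)⟩
    ⟨_, fun x => ∑ y, |w x y|, fun _ => 0, fun x y _ => by
      simpa using (le_abs_self (w x y)).trans
        (Finset.single_le_sum (f := fun y => |w x y|) (fun _ _ => abs_nonneg _)
          (Finset.mem_univ y)), rfl⟩
  let t : α → Finset α := fun x => {y | E x y ∧ a x + b y = w x y}
  have hall : ∀ S : Finset α, S.card ≤ (S.biUnion t).card := by
    intro S
    have h := hmin _ ⟨fun x => a x - if x ∈ S then 1 else 0,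
      fun y => b y + if y ∈ S.biUnion t then 1 else 0, fun x y hxy => by
        have h₁ := hab x y hxy
        by_cases hx : x ∈ S
        · by_cases hy : y ∈ S.biUnion t
          · simp only [hx, hy, if_true]
            linarith
          · have h₂ : a x + b y ≠ w x y := fun h₂ =>
              hy (Finset.mem_biUnion.2 ⟨x, hx, by simp [t, hxy, h₂]⟩)
            simp only [hx, hy, if_true, if_false]
            omega
        · simp only [hx, if_false]
          split_ifs <;> linarith, rfl⟩
    simp only [Finset.sum_add_distrib, Finset.sum_sub_distrib, Finset.sum_boole,
      Finset.filter_univ_mem] at h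
    omega
  obtain ⟨f, hf, hft⟩ := (Finset.all_card_le_biUnion_card_iff_exists_injective t).1 hall
  exact ⟨a, b, Equiv.ofBijective f (Finite.injective_iff_bijective.1 hf), hab, fun x => by
    simpa [t] using hft x⟩

/-- `PermReach σ i n v` says that `n + 1` applications of `σ` lead from `Sum.inr i` to `Sum.inl v`
without leaving the left summand after the first one. -/
inductive PermReach {V ι : Type*} (σ : Equiv.Perm (V ⊕ ι)) (i : ι) : ℕ → V → Prop
  | start {v : V} (h : σ (.inr i) = .inl v) : PermReach σ i 0 v
  | step {n : ℕ} {u v : V} (hu : PermReach σ i n u) (h : σ (.inl u) = .inl v) :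
      PermReach σ i (n + 1) v

namespace PermReach

variable {V ι : Type*} {σ : Equiv.Perm (V ⊕ ι)} {i j : ι} {m n : ℕ} {u v : V}

theorem left_unique (hi : PermReach σ i m v) (hj : PermReach σ j n v) : i = j := by
  induction hi generalizing n with
  | start h =>
    cases hj with
    | start h' => simpa using σ.injective (h.trans h'.symm)
    | step _ h' => simpa using σ.injective (h.trans h'.symm)
  | step _ h ih =>
    cases hj with
    | start h' => simpa using σ.injective (h.trans h'.symm)
    | step hu h' =>
      obtain rfl := Sum.inl_injective (σ.injective (h.trans h'.symm))
      exact ih hu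

theorem right_unique (hu : PermReach σ i n u) (hv : PermReach σ i n v) : u = v := by
  induction hu generalizing v with
  | start h =>
    cases hv with
    | start h' => exact Sum.inl_injective (h.symm.trans h')
  | step _ h ih =>
    cases hv with
    | step hu h' =>
      obtain rfl := ih hu
      exact Sum.inl_injective (h.symm.trans h')

variable [PartialOrder V]

theorem le_of_le (hσ : ∀ u v, σ (.inl u) = .inl v → u ≤ v) (hu : PermReach σ i m u)
    (hv : PermReach σ i n v) (hmn : m ≤ n) : u ≤ v := by
  induction hv with
  | start h =>
    obtain rfl := Nat.le_zero.1 hmn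
    exact (hu.right_unique (.start h)).le
  | step hw h ih =>
    rcases hmn.eq_or_lt with rfl | hlt
    · exact (hu.right_unique (hw.step h)).le
    · exact (ih (Nat.lt_succ_iff.1 hlt)).trans (hσ _ _ h)

theorem exists_of_ne [WellFoundedLT V] (hσ : ∀ u v, σ (.inl u) = .inl v → u ≤ v) (v : V)
    (hv : σ.symm (.inl v) ≠ .inl v) : ∃ i n, PermReach σ i n v := by
  induction v using WellFoundedLT.induction with
  | ind v ih =>
    rcases h : σ.symm (.inl v) with u | i
    · have h' : σ (.inl u) = .inl v := by rw [← h, Equiv.apply_symm_apply]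
      have huv : u ≠ v := fun e => hv (e ▸ h)
      obtain ⟨i, n, hu⟩ := ih u ((hσ u v h').lt_of_ne huv) fun e => huv <| Sum.inl_injective <| by
        rw [← h', ← e, Equiv.apply_symm_apply, e]
      exact ⟨i, _, hu.step h'⟩
    · exact ⟨i, 0, .start (by rw [← h, Equiv.apply_symm_apply])⟩

end PermReach

section Duality

variable {V : Type*} [DecidableEq V] [PartialOrder V]

theorem card_inter_le_one_of_isChain_of_isAntichain {C A : Finset V}
    (hC : IsChain (· ≤ ·) (C : Set V)) (hA : IsAntichain (· ≤ ·) (A : Set V)) :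
    (C ∩ A).card ≤ 1 := by
  refine Finset.card_le_one.2 fun x hx y hy => ?_
  rw [Finset.mem_inter] at hx hy
  rcases hC.total hx.1 hy.1 with h | h
  · exact hA.eq hx.2 hy.2 h
  · exact (hA.eq hy.2 hx.2 h).symm

variable [Fintype V]

theorem card_biUnion_chains_le_antichain_norm {k m : ℕ} {C : Fin k → Finset V}
    {A : Fin m → Finset V} (hC : ∀ i, IsChain (· ≤ ·) (C i : Set V))
    (hA : ∀ j, IsAntichain (· ≤ ·) (A j : Set V)) :
    (Finset.univ.biUnion C).card ≤ (Finset.univ \ Finset.univ.biUnion A).card + k * m := by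
  have hsub : Finset.univ.biUnion C ⊆ (Finset.univ \ Finset.univ.biUnion A) ∪
      (Finset.univ : Finset (Fin k × Fin m)).biUnion fun p => C p.1 ∩ A p.2 := by
    intro v hv
    simp only [Finset.mem_biUnion, Finset.mem_univ, true_and, Finset.mem_union, Finset.mem_sdiff,
      Finset.mem_inter, Prod.exists] at hv ⊢
    by_cases h : ∃ j, v ∈ A j
    · obtain ⟨i, hi⟩ := hv
      obtain ⟨j, hj⟩ := h
      exact .inr ⟨i, j, hi, hj⟩
    · exact .inl h
  refine (Finset.card_le_card hsub).trans <| (Finset.card_union_le _ _).trans <|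
    Nat.add_le_add_left ?_ _
  refine (Finset.card_biUnion_le_card_mul _ _ 1 fun p _ =>
    card_inter_le_one_of_isChain_of_isAntichain (hC p.1) (hA p.2)).trans ?_
  simp

theorem exists_chains_of_perm_s3 {k : ℕ} (σ : Equiv.Perm (V ⊕ Fin k))
    (hσ : ∀ u v, σ (.inl u) = .inl v → u ≤ v) :
    ∃ C : Fin k → Finset V, (∀ i, IsChain (· ≤ ·) (C i : Set V)) ∧
      (∀ i j, i ≠ j → Disjoint (C i) (C j)) ∧
      (Finset.univ.filter fun v => σ.symm (.inl v) ≠ .inl v).card ≤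
        (Finset.univ.biUnion C).card := by
  classical
  refine ⟨fun i => {v | ∃ n, PermReach σ i n v}, fun i u hu v hv _ => ?_, fun i j hij => ?_, ?_⟩
  · simp only [Finset.coe_filter, Finset.mem_univ, true_and, Set.mem_ofPred_eq] at hu hv
    obtain ⟨m, hu⟩ := hu
    obtain ⟨n, hv⟩ := hv
    exact (le_total m n).imp (hu.le_of_le hσ hv) (hv.le_of_le hσ hu)
  · refine Finset.disjoint_left.2 fun v hi hj => hij ?_
    simp only [Finset.mem_filter, Finset.mem_univ, true_and] at hi hj
    obtain ⟨m, hi⟩ := hi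
    obtain ⟨n, hj⟩ := hj
    exact hi.left_unique hj
  · refine Finset.card_le_card fun v hv => ?_
    simpa using PermReach.exists_of_ne hσ v (by simpa using hv)

/-- An integral dual solution of the assignment problem encoding `k` disjoint chains yields
a family of disjoint antichains whose `k`-norm is at most the dual value. -/
theorem exists_antichains_of_dual {k : ℕ} (hk : 0 < k) (a b : V ⊕ Fin k → ℤ)
    (hlt : ∀ u v, u < v → 1 ≤ a (.inl u) + b (.inl v))
    (hself : ∀ v, 0 ≤ a (.inl v) + b (.inl v))
    (hsource : ∀ i v, 1 ≤ a (.inr i) + b (.inl v))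
    (hsink : ∀ u j, 0 ≤ a (.inl u) + b (.inr j))
    (hpass : ∀ i j, 0 ≤ a (.inr i) + b (.inr j)) :
    ∃ (m : ℕ) (A : Fin m → Finset V), (∀ i, IsAntichain (· ≤ ·) (A i : Set V)) ∧
      (∀ i j, i ≠ j → Disjoint (A i) (A j)) ∧
      (((Finset.univ \ Finset.univ.biUnion A).card + k * m : ℕ) : ℤ) ≤ ∑ x, (a x + b x) := by
  have : Nonempty (Fin k) := ⟨⟨0, hk⟩⟩
  obtain ⟨s, hs⟩ := Finite.exists_min fun i : Fin k => a (.inr i)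
  obtain ⟨t, ht⟩ := Finite.exists_min fun j : Fin k => b (.inr j)
  obtain ⟨m, hm⟩ := Int.eq_ofNat_of_zero_le (hpass s t)
  let A : Fin m → Finset V := fun j =>
    {v | a (.inl v) + b (.inl v) = 0 ∧ a (.inl v) + b (.inr t) = (j : ℕ)}
  refine ⟨m, A, fun j u hu v hv huv hle => ?_, fun i j hij => ?_, ?_⟩
  · simp only [A, Finset.coe_filter, Finset.mem_univ, true_and, Set.mem_ofPred_eq] at hu hv
    have := hlt u v (lt_of_le_of_ne hle huv)
    omega
  · refine Finset.disjoint_left.2 fun v hi hj => hij (Fin.ext ?_)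
    simp only [A, Finset.mem_filter, Finset.mem_univ, true_and] at hi hj
    omega
  · have hcard : ((Finset.univ \ Finset.univ.biUnion A).card : ℤ) ≤
        ∑ v, (a (.inl v) + b (.inl v)) := by
      rw [Finset.card_eq_sum_ones, Nat.cast_sum]
      refine (Finset.sum_le_sum fun v hv => ?_).trans
        (Finset.sum_le_sum_of_subset_of_nonneg (Finset.subset_univ _) fun v _ _ => hself v)
      have hpos : a (.inl v) + b (.inl v) ≠ 0 := by
        intro h0
        obtain ⟨j, hj⟩ := Int.eq_ofNat_of_zero_le (hsink v t)
        have hjm : j < m := by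
          have := hsource s v
          omega
        exact (Finset.mem_sdiff.1 hv).2
          (Finset.mem_biUnion.2 ⟨⟨j, hjm⟩, Finset.mem_univ _, by simp [A, h0, hj]⟩)
      have := hself v
      push_cast
      omega
    have hends : (k * m : ℤ) ≤ ∑ i : Fin k, (a (.inr i) + b (.inr i)) := by
      have := Finset.card_nsmul_le_sum Finset.univ
        (fun i : Fin k => a (.inr i) + b (.inr i)) (m : ℤ) fun i _ => by
          have := hs i
          have := ht i
          omega
      simpa using this
    rw [Fintype.sum_sum_type]
    push_cast
    linarith

theorem exists_chains_antichains_norm_le {k : ℕ} (hk : 0 < k) :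
    ∃ (C : Fin k → Finset V) (m : ℕ) (A : Fin m → Finset V),
      ((∀ i, IsChain (· ≤ ·) (C i : Set V)) ∧ ∀ i j, i ≠ j → Disjoint (C i) (C j)) ∧
      ((∀ i, IsAntichain (· ≤ ·) (A i : Set V)) ∧ ∀ i j, i ≠ j → Disjoint (A i) (A j)) ∧
      (Finset.univ \ Finset.univ.biUnion A).card + k * m ≤ (Finset.univ.biUnion C).card := by
  obtain ⟨a, b, σ, hab, hσ⟩ := exists_perm_tight_dual (α := V ⊕ Fin k)
    (fun x y => ∀ u v, x = .inl u → y = .inl v → u ≤ v)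
    (fun x u v hu hv => (Sum.inl_injective (hu.symm.trans hv)).le)
    (fun x y => if y.isLeft ∧ x ≠ y then 1 else 0)
  obtain ⟨C, hC, hCd, hCc⟩ := exists_chains_of_perm_s3 σ fun u v h => (hσ (.inl u)).1 u v rfl h
  obtain ⟨m, A, hA, hAd, hAc⟩ := exists_antichains_of_dual hk a b
    (fun u v h => by
      simpa [h.ne] using hab (.inl u) (.inl v) (by rintro _ _ ⟨⟩ ⟨⟩; exact h.le))
    (fun v => by simpa using hab (.inl v) (.inl v) (by rintro _ _ ⟨⟩ ⟨⟩; exact le_rfl))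
    (fun i v => by simpa using hab (.inr i) (.inl v) (by rintro _ _ ⟨⟩))
    (fun u j => by simpa using hab (.inl u) (.inr j) (by rintro _ _ _ ⟨⟩))
    (fun i j => by simpa using hab (.inr i) (.inr j) (by rintro _ _ ⟨⟩))
  refine ⟨C, m, A, ⟨hC, hCd⟩, ⟨hA, hAd⟩, ?_⟩
  have hval : ∑ x, (a x + b x) =
      ((Finset.univ.filter fun v => σ.symm (.inl v) ≠ .inl v).card : ℤ) := by
    calc ∑ x, (a x + b x) = ∑ x, (a x + b (σ x)) := by
          rw [Finset.sum_add_distrib, Finset.sum_add_distrib, Equiv.sum_comp σ b]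
      _ = ∑ y, (a (σ.symm y) + b (σ (σ.symm y))) :=
          (Equiv.sum_comp σ.symm fun x => a x + b (σ x)).symm
      _ = _ := by
          simp_rw [(hσ _).2, Fintype.sum_sum_type]
          simp [Finset.card_filter]
  rw [hval] at hAc
  exact (Int.ofNat_le.1 hAc).trans hCc

end Duality

/-- **Schrijver's form of the dual Greene–Kleitman theorem.** For every finite poset `V`
and positive integer `k`, the maximum cardinality of the union of `k` pairwise disjoint
chains equals the minimum, over all finite families `A` of pairwise disjoint antichains
(indexed by `Fin m`), of `|V \ ⋃ A| + k * |A|`. -/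
theorem greene_kleitman_dual_schrijver (V : Type) [Fintype V] [DecidableEq V] [PartialOrder V]
    (k : ℕ) (hk : 0 < k) :
    sSup {n : ℕ | ∃ C : Fin k → Finset V,
        (∀ i, IsChain (· ≤ ·) ((C i : Finset V) : Set V)) ∧
        (∀ i j, i ≠ j → Disjoint (C i) (C j)) ∧
        n = (Finset.univ.biUnion C).card} =
    sInf {n : ℕ | ∃ (m : ℕ) (A : Fin m → Finset V),
        (∀ i, IsAntichain (· ≤ ·) ((A i : Finset V) : Set V)) ∧
        (∀ i j, i ≠ j → Disjoint (A i) (A j)) ∧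
        n = (Finset.univ \ Finset.univ.biUnion A).card + k * m} := by
  obtain ⟨C, m, A, ⟨hC, hCd⟩, ⟨hA, hAd⟩, hle⟩ := exists_chains_antichains_norm_le (V := V) hk
  refine le_antisymm (csSup_le ?_ ?_) ?_
  · exact ⟨_, C, hC, hCd, rfl⟩
  · rintro _ ⟨C', hC', -, rfl⟩
    refine le_csInf ⟨_, m, A, hA, hAd, rfl⟩ ?_
    rintro _ ⟨m', A', hA', -, rfl⟩
    exact card_biUnion_chains_le_antichain_norm hC' hA'
  · refine le_trans (Nat.sInf_le ?_) (hle.trans (le_csSup ?_ ?_))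
    · exact ⟨m, A, hA, hAd, rfl⟩
    · refine ⟨Fintype.card V, ?_⟩
      rintro _ ⟨C', -, -, rfl⟩
      exact Finset.card_le_univ _
    · exact ⟨C, hC, hCd, rfl⟩
end
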